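/- Let c ∈ C⁴(cl U × cl V) satisfy (B0)–(B3), fix ȳ ∈ cl V, and let u be c-convex with modified potential ũ(q) := u(x(q)) + c(x(q), ȳ) and modified cost c̃(q, y) := c(x(q), y) − c(x(q), ȳ). If λ ≤ |∂ᶜu| ≤ Λ on U′ ⊂ cl U, then λ/γ_c⁺ ≤ |∂^{c̃}ũ| ≤ Λ γ_c⁻ on U′_ȳ := −D_y c(U′, ȳ), where γ_c^± := ‖det(D²_{xy} c)^{±1}‖_{L∞(U′×V)}. Furthermore γ^±_{c̃}(U′_ȳ × V) ≤ γ_c⁺ γ_c⁻ and β^±_{c̃}(U′_ȳ × V) ≤ β_c⁺ β_c⁻, with β_c^± := ‖(D²_{xy} c)^{±1}‖_{L∞(U′×V)}. -/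

import Mathlib

open Set MeasureTheory Metric Bornology
open scoped ENNReal NNReal Pointwise

noncomputable section

abbrev Euc (n : ℕ) := EuclideanSpace ℝ (Fin n)

/-- Partial gradient of the cost in the first variable: `D_x c(x,y)`. -/
noncomputable def gradX (n : ℕ) (c : Euc n → Euc n → ℝ) (x y : Euc n) : Euc n :=
  gradient (fun x' => c x' y) x

/-- Partial gradient of the cost in the second variable: `D_y c(x,y)`. -/
noncomputable def gradY (n : ℕ) (c : Euc n → Euc n → ℝ) (x y : Euc n) : Euc n :=
  gradient (fun y' => c x y') y

/-- Mixed second derivative `D²_{xy} c` as a continuous linear map. -/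
noncomputable def DxyC (n : ℕ) (c : Euc n → Euc n → ℝ) (x y : Euc n) : Euc n →L[ℝ] Euc n :=
  fderiv ℝ (fun x' => gradY n c x' y) x

/-- Second derivative `D²_{xx} c`. -/
noncomputable def DxxC (n : ℕ) (c : Euc n → Euc n → ℝ) (x y : Euc n) : Euc n →L[ℝ] Euc n :=
  fderiv ℝ (fun x' => gradX n c x' y) x

/-- Third derivative `D²_{xx} D_y c`. -/
noncomputable def DxxyC (n : ℕ) (c : Euc n → Euc n → ℝ) (x y : Euc n) :
    Euc n →L[ℝ] Euc n →L[ℝ] Euc n :=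
  fderiv ℝ (fun x' => DxyC n c x' y) x

/-- `β⁺_c = ‖D²_{xy} c‖_{L∞(U×V)}`. -/
noncomputable def betaPlus (n : ℕ) (c : Euc n → Euc n → ℝ) (U V : Set (Euc n)) : ℝ :=
  sSup ((fun p : Euc n × Euc n => ‖DxyC n c p.1 p.2‖) '' (U ×ˢ V))

/-- `β⁻_c = ‖(D²_{xy} c)⁻¹‖_{L∞(U×V)}`. -/
noncomputable def betaMinus (n : ℕ) (c : Euc n → Euc n → ℝ) (U V : Set (Euc n)) : ℝ :=
  sSup ((fun p : Euc n × Euc n => ‖(DxyC n c p.1 p.2).inverse‖) '' (U ×ˢ V))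

/-- `γ⁺_c = ‖det D²_{xy} c‖_{L∞(U×V)}`. -/
noncomputable def gammaPlus (n : ℕ) (c : Euc n → Euc n → ℝ) (U V : Set (Euc n)) : ℝ :=
  sSup ((fun p : Euc n × Euc n =>
    |LinearMap.det ((DxyC n c p.1 p.2 : Euc n →L[ℝ] Euc n) : Euc n →ₗ[ℝ] Euc n)|) '' (U ×ˢ V))

/-- `γ⁻_c = ‖(det D²_{xy} c)⁻¹‖_{L∞(U×V)}`. -/
noncomputable def gammaMinus (n : ℕ) (c : Euc n → Euc n → ℝ) (U V : Set (Euc n)) : ℝ :=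
  sSup ((fun p : Euc n × Euc n =>
    |LinearMap.det ((DxyC n c p.1 p.2 : Euc n →L[ℝ] Euc n) : Euc n →ₗ[ℝ] Euc n)|⁻¹) '' (U ×ˢ V))

noncomputable def supDxx (n : ℕ) (c : Euc n → Euc n → ℝ) (U V : Set (Euc n)) : ℝ :=
  sSup ((fun p : Euc n × Euc n => ‖DxxC n c p.1 p.2‖) '' (U ×ˢ V))

noncomputable def supDx (n : ℕ) (c : Euc n → Euc n → ℝ) (U V : Set (Euc n)) : ℝ :=
  sSup ((fun p : Euc n × Euc n => ‖gradX n c p.1 p.2‖) '' (U ×ˢ V))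

noncomputable def supDxxy (n : ℕ) (c : Euc n → Euc n → ℝ) (U V : Set (Euc n)) : ℝ :=
  sSup ((fun p : Euc n × Euc n => ‖DxxyC n c p.1 p.2‖) '' (U ×ˢ V))

/-- The constant `M_c` from Theorem 4.3. -/
noncomputable def Mconst (n : ℕ) (c : Euc n → Euc n → ℝ) (U V : Set (Euc n)) : ℝ :=
  (betaMinus n c U V) ^ 2 * supDxx n c U V +
    (betaMinus n c U V) ^ 3 * supDx n c U V * supDxxy n c U V

/-- The constant `ε_c` of Lemma 6.1: `1/ε_c = 2 (β⁺)⁴ (β⁻)⁶ ‖D³_{xxy} c‖_∞`. -/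
noncomputable def epsC (n : ℕ) (c : Euc n → Euc n → ℝ) (U V : Set (Euc n)) : ℝ :=
  (2 * (betaPlus n c U V) ^ 4 * (betaMinus n c U V) ^ 6 * supDxxy n c U V)⁻¹

/-- Condition (B0). -/
def B0cond (n : ℕ) (c : Euc n → Euc n → ℝ) (U V : Set (Euc n)) : Prop :=
  IsOpen U ∧ IsBounded U ∧ IsOpen V ∧ IsBounded V ∧
    ContDiffOn ℝ 4 (Function.uncurry c) (closure U ×ˢ closure V)

/-- `f` is a (C¹-) diffeomorphism from `S` onto its range. -/
def DiffeoOnto (n : ℕ) (f : Euc n → Euc n) (S : Set (Euc n)) : Prop :=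
  Set.InjOn f S ∧ ContDiffOn ℝ 1 f S ∧ ContDiffOn ℝ 1 (Function.invFunOn f S) (f '' S)

/-- Condition (B1) (bi-twist). -/
def B1cond (n : ℕ) (c : Euc n → Euc n → ℝ) (U V : Set (Euc n)) : Prop :=
  (∀ y ∈ closure V, DiffeoOnto n (fun x => -gradY n c x y) (closure U)) ∧
  (∀ x ∈ closure U, DiffeoOnto n (fun y => -gradX n c x y) (closure V))

/-- `U_ȳ := -D_y c(U, ȳ)`. -/
def Uyset (n : ℕ) (c : Euc n → Euc n → ℝ) (U : Set (Euc n)) (ybar : Euc n) : Set (Euc n) :=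
  (fun x => -gradY n c x ybar) '' U

/-- `V_x̄ := -D_x c(x̄, V)`. -/
def Vxset (n : ℕ) (c : Euc n → Euc n → ℝ) (V : Set (Euc n)) (xbar : Euc n) : Set (Euc n) :=
  (fun y => -gradX n c xbar y) '' V

/-- Condition (B2) (bi-convexity). -/
def B2cond (n : ℕ) (c : Euc n → Euc n → ℝ) (U V : Set (Euc n)) : Prop :=
  (∀ y ∈ closure V, Convex ℝ (Uyset n c U y)) ∧ (∀ x ∈ closure U, Convex ℝ (Vxset n c V x))

/-- A strongly convex set: each boundary point is touched from outside by a sphere of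
radius `R` enclosing the set. -/
def StronglyConvexSet (n : ℕ) (Q : Set (Euc n)) : Prop :=
  Convex ℝ Q ∧ ∃ R : ℝ, 0 < R ∧ ∀ x ∈ frontier Q, ∃ z : Euc n, dist x z = R ∧ Q ⊆ closedBall z R

/-- Condition (B2s). -/
def B2scond (n : ℕ) (c : Euc n → Euc n → ℝ) (U V : Set (Euc n)) : Prop :=
  (∀ y ∈ closure V, StronglyConvexSet n (Uyset n c U y)) ∧
  (∀ x ∈ closure U, StronglyConvexSet n (Vxset n c V x))

/-- An affinely parameterized line segment on `[-1,1]`. -/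
def IsAffineSeg (n : ℕ) (F : ℝ → Euc n × Euc n) : Prop :=
  ∃ a b : Euc n × Euc n, ∀ t ∈ Icc (-1 : ℝ) 1, F t = a + t • b

/-- `∂²/∂s∂t c(x(s), y(t))` at `(0,0)`. -/
noncomputable def crossDiff2 (n : ℕ) (c : Euc n → Euc n → ℝ) (x y : ℝ → Euc n) : ℝ :=
  deriv (fun s => deriv (fun t => c (x s) (y t)) 0) 0

/-- `∂⁴/∂s²∂t² c(x(s), y(t))` at `(0,0)`. -/
noncomputable def crossDiff4 (n : ℕ) (c : Euc n → Euc n → ℝ) (x y : ℝ → Euc n) : ℝ :=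
  deriv (deriv (fun s => deriv (deriv (fun t => c (x s) (y t))) 0)) 0

/-- Condition (B3) (= A3w). -/
def B3cond (n : ℕ) (c : Euc n → Euc n → ℝ) (U V : Set (Euc n)) : Prop :=
  ∀ x y : ℝ → Euc n, (∀ t ∈ Icc (-1 : ℝ) 1, x t ∈ closure U) →
    (∀ t ∈ Icc (-1 : ℝ) 1, y t ∈ closure V) →
    IsAffineSeg n (fun t => (gradY n c (x t) (y 0), gradX n c (x 0) (y t))) →
    crossDiff2 n c x y = 0 → crossDiff4 n c x y ≤ 0

/-- Condition (B4) (non-negative cross-curvature). -/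
def B4cond (n : ℕ) (c : Euc n → Euc n → ℝ) (U V : Set (Euc n)) : Prop :=
  ∀ x y : ℝ → Euc n, (∀ t ∈ Icc (-1 : ℝ) 1, x t ∈ closure U) →
    (∀ t ∈ Icc (-1 : ℝ) 1, y t ∈ closure V) →
    IsAffineSeg n (fun t => (gradY n c (x t) (y 0), gradX n c (x 0) (y t))) →
    crossDiff4 n c x y ≤ 0

/-- The `c*`-transform `u^{c*}(y) = sup_{x ∈ A} (-c(x,y) - u(x))`. -/
noncomputable def cStarT (n : ℕ) (c : Euc n → Euc n → ℝ) (A : Set (Euc n)) (u : Euc n → ℝ)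
    (y : Euc n) : ℝ :=
  sSup ((fun x => -c x y - u x) '' A)

/-- `u` is `c`-convex on `A` (relative to the target set `B`): `u = (u^{c*})^c`. -/
def CConvexOn (n : ℕ) (c : Euc n → Euc n → ℝ) (A B : Set (Euc n)) (u : Euc n → ℝ) : Prop :=
  ∀ x ∈ A, u x = sSup ((fun y => -c x y - cStarT n c A u y) '' B)

/-- The `c`-subdifferential `∂ᶜu ⊂ A × B`. -/
def cSubdiff (n : ℕ) (c : Euc n → Euc n → ℝ) (A B : Set (Euc n)) (u : Euc n → ℝ) :
    Set (Euc n × Euc n) :=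
  {p | p.1 ∈ A ∧ p.2 ∈ B ∧ u p.1 + cStarT n c A u p.2 + c p.1 p.2 = 0}

def cSubdiffAt (n : ℕ) (c : Euc n → Euc n → ℝ) (A B : Set (Euc n)) (u : Euc n → ℝ)
    (x : Euc n) : Set (Euc n) :=
  {y | (x, y) ∈ cSubdiff n c A B u}

def cSubdiffImg (n : ℕ) (c : Euc n → Euc n → ℝ) (A B : Set (Euc n)) (u : Euc n → ℝ)
    (X : Set (Euc n)) : Set (Euc n) :=
  ⋃ x ∈ X, cSubdiffAt n c A B u x

/-- `∂^{c*}u^{c*}(Y) = {x : ∃ y ∈ Y, (x,y) ∈ ∂ᶜu}`. -/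
def cSubdiffPre (n : ℕ) (c : Euc n → Euc n → ℝ) (A B : Set (Euc n)) (u : Euc n → ℝ)
    (Y : Set (Euc n)) : Set (Euc n) :=
  {x | ∃ y ∈ Y, (x, y) ∈ cSubdiff n c A B u}

/-- `|∂ᶜu| ≥ lam` on `S`. -/
def MAge (n : ℕ) (c : Euc n → Euc n → ℝ) (A B : Set (Euc n)) (u : Euc n → ℝ) (lam : ℝ)
    (S : Set (Euc n)) : Prop :=
  ∀ X : Set (Euc n), X ⊆ S → MeasurableSet X →
    ENNReal.ofReal lam * volume X ≤ volume (cSubdiffImg n c A B u X)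

/-- `|∂ᶜu| ≤ lam` on `S`. -/
def MAle (n : ℕ) (c : Euc n → Euc n → ℝ) (A B : Set (Euc n)) (u : Euc n → ℝ) (lam : ℝ)
    (S : Set (Euc n)) : Prop :=
  ∀ X : Set (Euc n), X ⊆ S → MeasurableSet X →
    volume (cSubdiffImg n c A B u X) ≤ ENNReal.ofReal lam * volume X

/-- The inverse of the cost-exponential coordinate change `q(x) = -D_y c(x, ȳ)`. -/
noncomputable def xOf (n : ℕ) (c : Euc n → Euc n → ℝ) (U : Set (Euc n)) (ybar : Euc n) :
    Euc n → Euc n :=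
  Function.invFunOn (fun x => -gradY n c x ybar) (closure U)

/-- `cl U_ȳ := -D_y c(cl U, ȳ)`. -/
def clUy (n : ℕ) (c : Euc n → Euc n → ℝ) (U : Set (Euc n)) (ybar : Euc n) : Set (Euc n) :=
  (fun x => -gradY n c x ybar) '' closure U

/-- The modified cost `c̃(q,y) = c(x(q), y) - c(x(q), ȳ)`. -/
noncomputable def modCost (n : ℕ) (c : Euc n → Euc n → ℝ) (U : Set (Euc n)) (ybar : Euc n)
    (q y : Euc n) : ℝ :=
  c (xOf n c U ybar q) y - c (xOf n c U ybar q) ybar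

/-- The modified potential `ũ(q) = u(x(q)) + c(x(q), ȳ)`. -/
noncomputable def modPot (n : ℕ) (c : Euc n → Euc n → ℝ) (U : Set (Euc n)) (ybar : Euc n)
    (u : Euc n → ℝ) (q : Euc n) : ℝ :=
  u (xOf n c U ybar q) + c (xOf n c U ybar q) ybar

/-- The `c̃`-cone generated by `qt` and `Q` with height `-h0 > 0`. -/
noncomputable def cConeFun (n : ℕ) (ct : Euc n → Euc n → ℝ) (B Q : Set (Euc n)) (qt : Euc n)
    (h0 : ℝ) (q : Euc n) : ℝ :=
  sSup {r : ℝ | ∃ y ∈ B, r = -ct q y + ct qt y + h0 ∧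
    ∀ p ∈ frontier Q, -ct p y + ct qt y + h0 ≤ 0}

/-- The ordinary subdifferential `∂u(x)` relative to a domain `A`. -/
def subdiffAt (n : ℕ) (A : Set (Euc n)) (u : Euc n → ℝ) (x : Euc n) : Set (Euc n) :=
  {p | ∀ ε > 0, ∃ δ > 0, ∀ x' ∈ A, ‖x' - x‖ < δ →
    u x + @inner ℝ _ _ p (x' - x) - ε * ‖x' - x‖ ≤ u x'}

/-- The dual norm `‖v‖*_K = sup_{w ∈ K} ⟨w, v⟩`. -/
noncomputable def dualNorm (n : ℕ) (K : Set (Euc n)) (v : Euc n) : ℝ :=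
  sSup ((fun w => (@inner ℝ _ _ w v : ℝ)) '' K)

/-- The section `S(x̄, ȳ, τ)`. -/
def sectS (n : ℕ) (c : Euc n → Euc n → ℝ) (U : Set (Euc n)) (u : Euc n → ℝ)
    (xbar ybar : Euc n) (τ : ℝ) : Set (Euc n) :=
  {x ∈ U | u x ≤ u xbar - c x ybar + c xbar ybar + τ}

/-- The measure with density `f` restricted to `A`. -/
noncomputable def densMeasure (n : ℕ) (A : Set (Euc n)) (f : Euc n → ℝ) : Measure (Euc n) :=
  (volume.restrict A).withDensity fun x => ENNReal.ofReal (f x)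

end

theorem aux_geom (n : ℕ) (f : Euc n → Euc n) (S : Set (Euc n)) (hS : IsOpen S)
    (hb : IsBounded S) (hne : S.Nonempty) (hf : DiffeoOnto n f (closure S))
    (hc : Convex ℝ (f '' S)) :
    IsOpen (f '' S) ∧ f '' closure S = closure (f '' S) ∧ UniqueDiffOn ℝ (closure S) ∧
    volume (frontier S) = 0 ∧
    (∀ x ∈ closure S, ∀ f' : Euc n →L[ℝ] Euc n, HasFDerivWithinAt f f' (closure S) x → f'.IsInvertible ∧
      HasFDerivWithinAt (Function.invFunOn f (closure S)) f'.inverse (f '' closure S) (f x)) ∧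
    (∀ x ∈ frontier S, f x ∉ f '' S) := by
  obtain ⟨hinj, hf1, hg1⟩ := hf
  set g := Function.invFunOn f (closure S) with hg
  have hgf : ∀ x ∈ closure S, g (f x) = x := fun x hx => hinj.leftInvOn_invFunOn hx
  have hcpt : IsCompact (closure S) := hb.isCompact_closure
  have hgm : MapsTo g (f '' closure S) (closure S) := by
    rintro _ ⟨x, hx, rfl⟩; rw [hgf x hx]; exact hx
  have hfm : MapsTo f (closure S) (f '' closure S) := mapsTo_image _ _
  have hfg : ∀ q ∈ f '' closure S, f (g q) = q := by
    rintro _ ⟨x, hx, rfl⟩; rw [hgf x hx]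
  have hfd : DifferentiableOn ℝ f (closure S) := hf1.differentiableOn one_ne_zero
  have hgd : DifferentiableOn ℝ g (f '' closure S) := hg1.differentiableOn one_ne_zero
  have hopen : IsOpen (f '' S) := by
    rw [isOpen_iff_mem_nhds]
    rintro _ ⟨x, hx, rfl⟩
    have hxc := subset_closure hx
    have hnh : closure S ∈ nhds x := Filter.mem_of_superset (hS.mem_nhds hx) subset_closure
    have hcd : ContDiffAt ℝ 1 f x := hf1.contDiffAt hnh
    have hst := hcd.hasStrictFDerivAt one_ne_zero
    obtain ⟨g', hg'⟩ := hgd (f x) (hfm hxc)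
    have h1 : HasFDerivWithinAt (g ∘ f) (g'.comp (fderiv ℝ f x)) (closure S) x :=
      hg'.comp x hst.hasFDerivAt.hasFDerivWithinAt hfm
    have h2 : HasFDerivWithinAt id (g'.comp (fderiv ℝ f x)) (closure S) x :=
      h1.congr (fun z hz => (hgf z hz).symm) (hgf x hxc).symm
    have h3 := (h2.hasFDerivAt hnh).unique (hasFDerivAt_id x)
    have hinj' : Function.Injective (fderiv ℝ f x) := by
      intro a b hab
      have ha := DFunLike.congr_fun h3 a
      have hb := DFunLike.congr_fun h3 b
      simp at ha hb
      rw [← ha, ← hb, hab]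
    have hsurj : Function.Surjective (fderiv ℝ f x) :=
      (LinearMap.injective_iff_surjective (f := (fderiv ℝ f x : Euc n →ₗ[ℝ] Euc n))).1 hinj'
    rw [← hst.map_nhds_eq_of_surj (LinearMap.range_eq_top.2 hsurj)]
    exact Filter.image_mem_map (hS.mem_nhds hx)
  have hcl : f '' closure S = closure (f '' S) := by
    apply Subset.antisymm
    · exact hfd.continuousOn.image_closure
    · exact closure_minimal (image_mono subset_closure) (hcpt.image_of_continuousOn hfd.continuousOn).isClosed
  have huq : UniqueDiffOn ℝ (f '' closure S) := by
    rw [hcl]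
    refine uniqueDiffOn_convex hc.closure ?_
    exact (hne.image f).mono (interior_maximal subset_closure hopen)
  have hright : ∀ x ∈ closure S, ∀ f' g', HasFDerivWithinAt f f' (closure S) x →
      HasFDerivWithinAt g g' (f '' closure S) (f x) → f'.comp g' = .id ℝ _ ∧ g'.comp f' = .id ℝ _ := by
    intro x hx f' g' hf' hg'
    have hf'' : HasFDerivWithinAt f f' (closure S) (g (f x)) := by rwa [hgf x hx]
    have h1 := hf''.comp (f x) hg' hgm
    have h2 : HasFDerivWithinAt id (f'.comp g') (f '' closure S) (f x) :=
      h1.congr (fun z hz => (hfg z hz).symm) (hfg _ (hfm hx)).symm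
    have h3 := (huq _ (hfm hx)).eq h2 (hasFDerivWithinAt_id _ _)
    refine ⟨h3, ?_⟩
    have h4 : (f' : Euc n →ₗ[ℝ] Euc n) ∘ₗ (g' : Euc n →ₗ[ℝ] Euc n) = LinearMap.id := by
      ext1 v; exact DFunLike.congr_fun h3 v
    have h5 := (LinearMap.comp_eq_id_comm _ _).1 h4
    ext1 v; exact DFunLike.congr_fun h5 v
  have huqS : UniqueDiffOn ℝ (closure S) := by
    intro x hx
    obtain ⟨g', hg'⟩ := hgd (f x) (hfm hx)
    obtain ⟨f', hf'⟩ := hfd x hx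
    have h := (hright x hx f' g' hf' hg').2
    have hs : Function.Surjective g' := fun v => ⟨f' v, DFunLike.congr_fun h v⟩
    have := hg'.uniqueDiffWithinAt (huq _ (hfm hx)) hs.denseRange
    rw [hgf x hx, image_image] at this
    rwa [image_congr hgf, image_id'] at this
  have hfr : ∀ x ∈ frontier S, f x ∉ f '' S := by
    rintro x hx ⟨z, hz, hzx⟩
    rw [hS.frontier_eq] at hx
    exact hx.2 (hinj (subset_closure hz) hx.1 hzx ▸ hz)
  refine ⟨hopen, hcl, huqS, ?_, ?_, hfr⟩
  · have h0 : volume (frontier (f '' S)) = 0 := hc.addHaar_frontier volume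
    have h1 : f '' frontier S ⊆ frontier (f '' S) := by
      rintro _ ⟨x, hx, rfl⟩
      rw [hopen.frontier_eq]
      exact ⟨hcl ▸ hfm (frontier_subset_closure hx), hfr x hx⟩
    have h2 := addHaar_image_eq_zero_of_differentiableOn_of_addHaar_eq_zero volume
      (hgd.mono (image_mono frontier_subset_closure)) (measure_mono_null h1 h0)
    rwa [image_image, image_congr (fun x hx => hgf x (frontier_subset_closure hx)), image_id'] at h2
  · intro x hx f' hf'
    obtain ⟨g', hg'⟩ := hgd (f x) (hfm hx)
    obtain ⟨h1, h2⟩ := hright x hx f' g' hf' hg'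
    have hinv : f'.IsInvertible := ContinuousLinearMap.IsInvertible.of_inverse h1 h2
    refine ⟨hinv, ?_⟩
    rwa [ContinuousLinearMap.inverse_eq h1 h2]

/-- if `ψ` is constant off the closure of an open convex set, its full derivative vanishes on the boundary. -/
theorem aux_bdry (n : ℕ) (C : Set (Euc n)) (hC : IsOpen C) (hc : Convex ℝ C) (hne : C.Nonempty)
    (q : Euc n) (hq : q ∉ C) (ψ : Euc n → Euc n) (K : Euc n)
    (hψ : ∀ p ∉ closure C, ψ p = K) : fderiv ℝ ψ q = 0 := by
  by_cases hd : DifferentiableAt ℝ ψ q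
  swap
  · exact fderiv_zero_of_not_differentiableAt hd
  obtain ⟨F, hF⟩ := geometric_hahn_banach_open_point hc hC hq
  obtain ⟨a, ha⟩ := hne
  set H : Set (Euc n) := {p | F q < F p} with hH
  have hHo : IsOpen H := isOpen_lt continuous_const F.continuous
  have hHc : Convex ℝ H := convex_halfSpace_gt F.toLinearMap.isLinear _
  have hmem : ∀ t : ℝ, 0 < t → q + t • (q - a) ∈ H := by
    intro t ht
    have := mul_pos ht (sub_pos.2 (hF a ha))
    simp only [hH, mem_ofPred_eq, map_add, map_smul, map_sub, smul_eq_mul]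
    linarith
  have hqH : q ∈ closure H := by
    have h1 : Filter.Tendsto (fun t : ℝ => q + t • (q - a)) (nhdsWithin 0 (Ioi 0)) (nhds q) := by
      have : Continuous (fun t : ℝ => q + t • (q - a)) := by fun_prop
      have := (this.tendsto 0).mono_left (nhdsWithin_le_nhds (s := Ioi 0))
      simpa using this
    exact mem_closure_of_tendsto h1 (by filter_upwards [self_mem_nhdsWithin] with t ht using hmem t ht)
  have hHd : ∀ p ∈ H, ψ p = K := by
    intro p hp
    apply hψ
    intro hpc
    have : closure C ⊆ {p | F p ≤ F q} :=
      closure_minimal (fun z hz => (hF z hz).le) (isClosed_le F.continuous continuous_const)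
    have h1 : F p ≤ F q := this hpc
    have h2 : F q < F p := hp
    exact absurd h1 (not_le.2 h2)
  have hu : UniqueDiffWithinAt ℝ H q := by
    refine uniqueDiffWithinAt_convex hHc ?_ hqH
    rw [hHo.interior_eq]; exact ⟨_, hmem 1 one_pos⟩
  have hqK : ψ q = K := by
    have := mem_closure_iff_nhdsWithin_neBot.1 hqH
    refine tendsto_nhds_unique (hd.continuousAt.tendsto.mono_left (nhdsWithin_le_nhds (s := H))) ?_
    refine tendsto_const_nhds.congr' ?_
    filter_upwards [self_mem_nhdsWithin] with p hp using (hHd p hp).symm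
  exact hu.eq hd.hasFDerivAt.hasFDerivWithinAt
    ((hasFDerivWithinAt_const K q H).congr hHd hqK)

theorem aux_A (n : ℕ) (c : Euc n → Euc n → ℝ) (U V : Set (Euc n))
    (hB0 : B0cond n c U V) (hB1 : B1cond n c U V)
    (hUu : UniqueDiffOn ℝ (closure U)) (hVu : UniqueDiffOn ℝ (closure V)) :
    ∃ A : Euc n → Euc n → Euc n →L[ℝ] Euc n,
      ContinuousOn (fun p : Euc n × Euc n => A p.1 p.2) (closure U ×ˢ closure V) ∧
      ∀ x ∈ closure U, ∀ y ∈ closure V,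
        HasFDerivWithinAt (fun x' => gradY n c x' y) (A x y) (closure U) x := by
  obtain ⟨hUo, hUb, hVo, hVb, hc⟩ := hB0
  set P := closure U ×ˢ closure V with hP
  have hPu : UniqueDiffOn ℝ P := hUu.prod hVu
  set D := fderivWithin ℝ (Function.uncurry c) P with hD
  have hDc : ContDiffOn ℝ 3 D P := hc.fderivWithin hPu (by norm_num)
  let T : ((Euc n × Euc n) →L[ℝ] ℝ) →L[ℝ] Euc n :=
    ((InnerProductSpace.toDual ℝ (Euc n)).symm.toContinuousLinearEquiv.toContinuousLinearMap).comp
      ((ContinuousLinearMap.compL ℝ (Euc n) (Euc n × Euc n) ℝ).flip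
        (ContinuousLinearMap.inr ℝ (Euc n) (Euc n)))
  let G : Euc n × Euc n → Euc n := fun p => T (D p)
  have hGc : ContDiffOn ℝ 3 G P := T.contDiff.comp_contDiffOn hDc
  have hpart : ∀ x ∈ closure U, ∀ y ∈ closure V,
      HasGradientWithinAt (fun y' => c x y') (G (x, y)) (closure V) y := by
    intro x hx y hy
    have h1 : HasFDerivWithinAt (Function.uncurry c) (D (x, y)) P (x, y) :=
      ((hc.differentiableOn (by norm_num)) (x, y) ⟨hx, hy⟩).hasFDerivWithinAt
    have h2 := h1.comp (s := closure V) y (hasFDerivAt_prodMk_right x y).hasFDerivWithinAt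
      (fun z hz => ⟨hx, hz⟩)
    rw [hasGradientWithinAt_iff_hasFDerivWithinAt]
    have h3 : (InnerProductSpace.toDual ℝ (Euc n)) (G (x, y)) =
        (D (x, y)).comp (ContinuousLinearMap.inr ℝ (Euc n) (Euc n)) :=
      (InnerProductSpace.toDual ℝ (Euc n)).apply_symm_apply _
    rw [h3]
    exact h2
  have hdiff : ∀ x ∈ closure U, ∀ y ∈ closure V, DifferentiableAt ℝ (fun y' => c x y') y →
      gradY n c x y = G (x, y) := by
    intro x hx y hy hd
    have h1 := hd.hasGradientAt
    have h2 := (hVu y hy).eq (hasGradientWithinAt_iff_hasFDerivWithinAt.1 (hpart x hx y hy))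
      (hasGradientAt_iff_hasFDerivAt.1 h1).hasFDerivWithinAt
    exact ((InnerProductSpace.toDual ℝ (Euc n)).injective h2).symm
  have hnd : ∀ x ∈ closure U, ∀ y ∈ closure V, gradY n c x y ≠ G (x, y) → gradY n c x y = 0 := by
    intro x hx y hy hne
    by_contra h
    apply hne
    apply hdiff x hx y hy
    by_contra h'
    exact h (gradient_eq_zero_of_not_differentiableAt h')
  have heq : ∀ x ∈ closure U, ∀ y ∈ closure V, gradY n c x y = G (x, y) := by
    intro x hx y hy
    by_contra hne
    rcases Nat.eq_zero_or_pos n with hn | hn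
    · subst hn; exact hne (Subsingleton.elim _ _)
    have : Nonempty (Fin n) := ⟨⟨0, hn⟩⟩
    have hcg : ContinuousOn (fun x' => gradY n c x' y) (closure U) := by
      have := ((hB1.1 y hy).2.1.continuousOn).neg
      exact this.congr (fun z _ => by simp)
    have hcG : ContinuousOn (fun x' => G (x', y)) (closure U) :=
      hGc.continuousOn.comp (by fun_prop) (fun z hz => ⟨hz, hy⟩)
    have hev : ∀ᶠ x' in nhdsWithin x (closure U), gradY n c x' y ≠ G (x', y) :=
      (((hcg.sub hcG) x hx).tendsto.eventually_ne (sub_ne_zero.2 hne)).mono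
        (fun _ h => sub_ne_zero.1 h)
    rw [eventually_nhdsWithin_iff] at hev
    obtain ⟨O, hO, hOo, hxO⟩ := _root_.eventually_nhds_iff.1 hev
    have hsub : ∀ z ∈ O ∩ U, z = x := by
      rintro z ⟨hz, hzU⟩
      have h1 := hnd z (subset_closure hzU) y hy (hO z hz (subset_closure hzU))
      have h2 := hnd x hx y hy hne
      exact (hB1.1 y hy).1 (subset_closure hzU) hx (by simp [h1, h2])
    obtain ⟨z, hz⟩ := mem_closure_iff.1 hx O hOo hxO
    have hs : O ∩ U = {x} := by
      ext w
      constructor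
      · intro hw; exact hsub w hw
      · intro hw
        have hw' : w = x := hw
        rw [hw', ← hsub z hz]; exact hz
    have : IsOpen ({x} : Set (Euc n)) := hs ▸ hOo.inter hUo
    exact not_isOpen_singleton x this
  refine ⟨fun x y => (fderivWithin ℝ G P (x, y)).comp (ContinuousLinearMap.inl ℝ (Euc n) (Euc n)),
    ?_, ?_⟩
  · have h1 : ContinuousOn (fderivWithin ℝ G P) P :=
      hGc.continuousOn_fderivWithin hPu (by norm_num)
    exact h1.clm_comp continuousOn_const
  · intro x hx y hy
    have h1 : HasFDerivWithinAt G (fderivWithin ℝ G P (x, y)) P (x, y) :=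
      ((hGc.differentiableOn (by norm_num)) (x, y) ⟨hx, hy⟩).hasFDerivWithinAt
    have h2 := h1.comp (s := closure U) (f := fun x' => (x', y)) x
      (hasFDerivAt_prodMk_left x y).hasFDerivWithinAt (fun z hz => ⟨hz, hy⟩)
    exact h2.congr (fun z hz => heq z hz y hy) (heq x hx y hy)

theorem aux_sup (n : ℕ) (c : Euc n → Euc n → ℝ) (U V U' : Set (Euc n))
    (hUb : IsBounded U) (hVb : IsBounded V) (hU' : U' ⊆ closure U)
    (A : Euc n → Euc n → Euc n →L[ℝ] Euc n)
    (hA : ContinuousOn (fun p : Euc n × Euc n => A p.1 p.2) (closure U ×ˢ closure V))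
    (hinv : ∀ x ∈ closure U, ∀ y ∈ closure V, (A x y).IsInvertible)
    (hD1 : ∀ x ∈ closure U, ∀ y ∈ V, DxyC n c x y = A x y ∨ DxyC n c x y = 0)
    (hD2 : ∀ x ∈ U, ∀ y ∈ V, DxyC n c x y = A x y)
    (φ : (Euc n →L[ℝ] Euc n) → ℝ)
    (hφ : ∀ L : Euc n →L[ℝ] Euc n, L.IsInvertible → ContinuousAt φ L)
    (x : Euc n) (hx : x ∈ U') (hxU : x ∈ U) (y : Euc n) (hy : y ∈ closure V) :
    φ (A x y) ≤ sSup ((fun p : Euc n × Euc n => φ (DxyC n c p.1 p.2)) '' (U' ×ˢ V)) := by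
  have hcont : ContinuousOn (fun p : Euc n × Euc n => φ (A p.1 p.2)) (closure U ×ˢ closure V) := by
    intro p hp
    exact ContinuousAt.comp_continuousWithinAt (f := fun p : Euc n × Euc n => A p.1 p.2)
      (hφ _ (hinv p.1 hp.1 p.2 hp.2)) (hA p hp)
  have hcpt : IsCompact (closure U ×ˢ closure V) :=
    hUb.isCompact_closure.prod hVb.isCompact_closure
  obtain ⟨M, hM⟩ := (hcpt.image_of_continuousOn hcont).bddAbove
  have hbdd : BddAbove ((fun p : Euc n × Euc n => φ (DxyC n c p.1 p.2)) '' (U' ×ˢ V)) := by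
    refine ⟨max M (φ 0), ?_⟩
    rintro _ ⟨p, hp, rfl⟩
    rcases hD1 p.1 (hU' hp.1) p.2 hp.2 with h | h
    · simp only [h]
      exact le_max_of_le_left (hM ⟨p, ⟨hU' hp.1, subset_closure hp.2⟩, rfl⟩)
    · simp only [h]
      exact le_max_right _ _
  have := mem_closure_iff_nhdsWithin_neBot.1 hy
  have hxc := subset_closure hxU
  have ht : Filter.Tendsto (fun y' => φ (A x y')) (nhdsWithin y V) (nhds (φ (A x y))) := by
    have h1 : ContinuousOn (fun y' => φ (A x y')) (closure V) :=
      hcont.comp (f := fun y' => (x, y')) (by fun_prop) (fun z hz => ⟨hxc, hz⟩)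
    exact (h1 y hy).mono_left (nhdsWithin_mono _ subset_closure)
  refine le_of_tendsto ht ?_
  filter_upwards [self_mem_nhdsWithin] with y' hy'
  rw [← hD2 x hxU y' hy']
  exact le_csSup hbdd ⟨(x, y'), ⟨hx, hy'⟩, rfl⟩

theorem aux_absdet_neg (n : ℕ) (L : Euc n →L[ℝ] Euc n) :
    |LinearMap.det ((-L : Euc n →L[ℝ] Euc n) : Euc n →ₗ[ℝ] Euc n)|
      = |LinearMap.det (L : Euc n →ₗ[ℝ] Euc n)| := by
  have : ((-L : Euc n →L[ℝ] Euc n) : Euc n →ₗ[ℝ] Euc n) = (-1 : ℝ) • (L : Euc n →ₗ[ℝ] Euc n) := by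
    ext1 v; simp
  rw [this, LinearMap.det_smul, abs_mul, abs_pow]
  simp

theorem aux_det_inv (n : ℕ) (L : Euc n →L[ℝ] Euc n) (hL : L.IsInvertible) :
    LinearMap.det (L.inverse : Euc n →ₗ[ℝ] Euc n) * LinearMap.det (L : Euc n →ₗ[ℝ] Euc n) = 1 := by
  rw [← LinearMap.det_comp]
  have : (L.inverse : Euc n →ₗ[ℝ] Euc n) ∘ₗ (L : Euc n →ₗ[ℝ] Euc n) = LinearMap.id := by
    ext1 v; exact DFunLike.congr_fun hL.inverse_comp_self v
  rw [this, LinearMap.det_id]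

theorem aux_neg_inv (n : ℕ) (L : Euc n →L[ℝ] Euc n) (hL : L.IsInvertible) :
    (-L).inverse = -L.inverse := by
  obtain ⟨e, rfl⟩ := hL
  apply ContinuousLinearMap.inverse_eq
  · ext1 v; simp
  · ext1 v; simp

theorem aux_img (n : ℕ) (c : Euc n → Euc n → ℝ) (U B : Set (Euc n)) (u : Euc n → ℝ) (ybar : Euc n)
    (hinj : InjOn (fun x => -gradY n c x ybar) (closure U)) (X : Set (Euc n)) :
    cSubdiffImg n (modCost n c U ybar) (clUy n c U ybar) B (modPot n c U ybar u) X =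
      cSubdiffImg n c (closure U) B u (closure U ∩ (fun x => -gradY n c x ybar) ⁻¹' X) := by
  have hgf : ∀ x ∈ closure U, xOf n c U ybar (-gradY n c x ybar) = x := fun x hx =>
    hinj.leftInvOn_invFunOn hx
  have hstar : ∀ y, cStarT n (modCost n c U ybar) (clUy n c U ybar) (modPot n c U ybar u) y =
      cStarT n c (closure U) u y := by
    intro y
    unfold cStarT clUy
    rw [image_image]
    congr 1
    apply image_congr
    intro x hx
    simp only [modCost, modPot, hgf x hx]
    ring
  ext y
  simp only [cSubdiffImg, cSubdiffAt, cSubdiff, mem_iUnion, mem_ofPred_eq, hstar, exists_prop,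
    mem_inter_iff, mem_preimage]
  constructor
  · rintro ⟨q, hq, ⟨x, hx, rfl⟩, hy, h⟩
    refine ⟨x, ⟨hx, hq⟩, hx, hy, ?_⟩
    simp only [modCost, modPot, hgf x hx] at h
    linarith
  · rintro ⟨x, ⟨hx, hq⟩, -, hy, h⟩
    refine ⟨_, hq, ⟨x, hx, rfl⟩, hy, ?_⟩
    simp only [modCost, modPot, hgf x hx]
    linarith

/-- Corollary 4.5: transformed `c̃`-Monge–Ampère inequalities. -/
theorem transformed_cMA_inequalities (n : ℕ) (c : Euc n → Euc n → ℝ)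
    (U V U' : Set (Euc n)) (u : Euc n → ℝ) (ybar : Euc n) (lam Lam : ℝ)
    (hB0 : B0cond n c U V) (hB1 : B1cond n c U V) (hB2 : B2cond n c U V)
    (hB3 : B3cond n c U V)
    (hy : ybar ∈ closure V)
    (hu : CConvexOn n c (closure U) (closure V) u)
    (hU' : U' ⊆ closure U) (hlam : 0 < lam) (hLam : 0 < Lam)
    (hge : MAge n c (closure U) (closure V) u lam U')
    (hle : MAle n c (closure U) (closure V) u Lam U') :
    -- `λ/γ⁺_c ≤ |∂^{c̃}ũ| ≤ Λ γ⁻_c` on `U'_ȳ = -D_y c(U', ȳ)`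
    MAge n (modCost n c U ybar) (clUy n c U ybar) (closure V) (modPot n c U ybar u)
      (lam / gammaPlus n c U' V) (Uyset n c U' ybar) ∧
    MAle n (modCost n c U ybar) (clUy n c U ybar) (closure V) (modPot n c U ybar u)
      (Lam * gammaMinus n c U' V) (Uyset n c U' ybar) ∧
    -- `γ^±_{c̃}(U'_ȳ × V) ≤ γ⁺_c γ⁻_c`
    gammaPlus n (modCost n c U ybar) (Uyset n c U' ybar) V
      ≤ gammaPlus n c U' V * gammaMinus n c U' V ∧
    gammaMinus n (modCost n c U ybar) (Uyset n c U' ybar) V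
      ≤ gammaPlus n c U' V * gammaMinus n c U' V ∧
    -- `β^±_{c̃}(U'_ȳ × V) ≤ β⁺_c β⁻_c`
    betaPlus n (modCost n c U ybar) (Uyset n c U' ybar) V
      ≤ betaPlus n c U' V * betaMinus n c U' V ∧
    betaMinus n (modCost n c U ybar) (Uyset n c U' ybar) V
      ≤ betaPlus n c U' V * betaMinus n c U' V := by
  classical
  obtain ⟨hUo, hUb, hVo, hVb, hcd⟩ := id hB0
  have hVne : V.Nonempty := by
    rcases V.eq_empty_or_nonempty with h | h
    · simp [h] at hy
    · exact h
  have hgp0 : 0 ≤ gammaPlus n c U' V := Real.sSup_nonneg (by rintro _ ⟨p, -, rfl⟩; positivity)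
  have hgm0 : 0 ≤ gammaMinus n c U' V := Real.sSup_nonneg (by rintro _ ⟨p, -, rfl⟩; positivity)
  have hbp0 : 0 ≤ betaPlus n c U' V := Real.sSup_nonneg (by rintro _ ⟨p, -, rfl⟩; positivity)
  have hbm0 : 0 ≤ betaMinus n c U' V := Real.sSup_nonneg (by rintro _ ⟨p, -, rfl⟩; positivity)
  rcases U.eq_empty_or_nonempty with hUe | hUne
  · have hU'e : U' = ∅ := by
      rw [hUe, closure_empty] at hU'
      exact subset_empty_iff.1 hU'
    have hYe : Uyset n c U' ybar = ∅ := by simp [Uyset, hU'e]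
    rw [hYe]
    refine ⟨?_, ?_, ?_, ?_, ?_, ?_⟩
    · intro X hX _
      rw [subset_empty_iff.1 hX]; simp
    · intro X hX _
      rw [subset_empty_iff.1 hX]; simp [cSubdiffImg]
    · refine le_trans (le_of_eq ?_) (mul_nonneg hgp0 hgm0); simp [gammaPlus]
    · refine le_trans (le_of_eq ?_) (mul_nonneg hgp0 hgm0); simp [gammaMinus]
    · refine le_trans (le_of_eq ?_) (mul_nonneg hbp0 hbm0); simp [betaPlus]
    · refine le_trans (le_of_eq ?_) (mul_nonneg hbp0 hbm0); simp [betaMinus]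
  set f : Euc n → Euc n := fun x => -gradY n c x ybar with hf
  obtain ⟨hfo, hfcl, hUu, hfr0, hfinv, hfrn⟩ :=
    aux_geom n f U hUo hUb hUne (hB1.1 ybar hy) (hB2.1 ybar hy)
  have hinjf : InjOn f (closure U) := (hB1.1 ybar hy).1
  have hVu : UniqueDiffOn ℝ (closure V) := by
    obtain ⟨x0, hx0⟩ := hUne
    exact (aux_geom n (fun y => -gradX n c x0 y) V hVo hVb hVne (hB1.2 x0 (subset_closure hx0))
      (hB2.2 x0 (subset_closure hx0))).2.2.1
  obtain ⟨A, hAc, hAd⟩ := aux_A n c U V hB0 hB1 hUu hVu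
  have hAinv : ∀ x ∈ closure U, ∀ y ∈ closure V, (A x y).IsInvertible := by
    intro x hx y hy'
    have h := aux_geom n (fun x => -gradY n c x y) U hUo hUb hUne (hB1.1 y hy') (hB2.1 y hy')
    have h1 := (h.2.2.2.2.1 x hx (-(A x y)) (hAd x hx y hy').neg).1
    obtain ⟨e, he⟩ := h1
    refine ⟨(ContinuousLinearEquiv.neg ℝ).trans e, ?_⟩
    ext1 v
    have := DFunLike.congr_fun he (-v)
    simpa using this
  have hD2 : ∀ x ∈ U, ∀ y ∈ V, DxyC n c x y = A x y := by
    intro x hx y hy'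
    have hnh : closure U ∈ nhds x := Filter.mem_of_superset (hUo.mem_nhds hx) subset_closure
    exact ((hAd x (subset_closure hx) y (subset_closure hy')).hasFDerivAt hnh).fderiv
  have hD1 : ∀ x ∈ closure U, ∀ y ∈ V, DxyC n c x y = A x y ∨ DxyC n c x y = 0 := by
    intro x hx y hy'
    by_cases hd : DifferentiableAt ℝ (fun x' => gradY n c x' y) x
    · left
      exact (hUu x hx).eq hd.hasFDerivAt.hasFDerivWithinAt (hAd x hx y (subset_closure hy'))
    · right
      exact fderiv_zero_of_not_differentiableAt hd
  have hdet0 : ∀ L : Euc n →L[ℝ] Euc n, L.IsInvertible →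
      LinearMap.det (L : Euc n →ₗ[ℝ] Euc n) ≠ 0 := fun L hL h => by
    have := aux_det_inv n L hL
    rw [h, mul_zero] at this
    exact zero_ne_one this
  have hcdet : Continuous (fun L : Euc n →L[ℝ] Euc n => LinearMap.det (L : Euc n →ₗ[ℝ] Euc n)) :=
    ContinuousLinearMap.continuous_det
  have bgp : ∀ x ∈ U', x ∈ U → ∀ y ∈ closure V,
      |LinearMap.det (A x y : Euc n →ₗ[ℝ] Euc n)| ≤ gammaPlus n c U' V := fun x hx hxU y hy' =>
    aux_sup n c U V U' hUb hVb hU' A hAc hAinv hD1 hD2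
      (fun L => |LinearMap.det (L : Euc n →ₗ[ℝ] Euc n)|)
      (fun L hL => hcdet.abs.continuousAt) x hx hxU y hy'
  have bgm : ∀ x ∈ U', x ∈ U → ∀ y ∈ closure V,
      |LinearMap.det (A x y : Euc n →ₗ[ℝ] Euc n)|⁻¹ ≤ gammaMinus n c U' V := fun x hx hxU y hy' =>
    aux_sup n c U V U' hUb hVb hU' A hAc hAinv hD1 hD2
      (fun L => |LinearMap.det (L : Euc n →ₗ[ℝ] Euc n)|⁻¹)
      (fun L hL => hcdet.abs.continuousAt.inv₀ (abs_ne_zero.2 (hdet0 L hL))) x hx hxU y hy'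
  have bbp : ∀ x ∈ U', x ∈ U → ∀ y ∈ closure V,
      ‖A x y‖ ≤ betaPlus n c U' V := fun x hx hxU y hy' =>
    aux_sup n c U V U' hUb hVb hU' A hAc hAinv hD1 hD2 (fun L => ‖L‖)
      (fun L hL => continuous_norm.continuousAt) x hx hxU y hy'
  have bbm : ∀ x ∈ U', x ∈ U → ∀ y ∈ closure V,
      ‖(A x y).inverse‖ ≤ betaMinus n c U' V := fun x hx hxU y hy' =>
    aux_sup n c U V U' hUb hVb hU' A hAc hAinv hD1 hD2 (fun L => ‖L.inverse‖)
      (fun L hL => by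
        obtain ⟨e, rfl⟩ := hL
        exact (contDiffAt_map_inverse (𝕜 := ℝ) (n := 0) e).continuousAt.norm) x hx hxU y hy'
  have hmod : ∀ x ∈ U', ∀ y ∈ V,
      (x ∈ U ∧ DxyC n (modCost n c U ybar) (f x) y = (A x y).comp (-(A x ybar).inverse)) ∨
      (0 < n ∧ DxyC n (modCost n c U ybar) (f x) y = 0) := by
    intro x hx y hy'
    have hxc := hU' hx
    have hgr : (fun q => gradY n (modCost n c U ybar) q y) =
        fun q => gradY n c (xOf n c U ybar q) y := by
      funext q
      simp only [gradY, gradient, modCost, fderiv_sub_const]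
    have hD : DxyC n (modCost n c U ybar) (f x) y =
        fderiv ℝ (fun q => gradY n c (xOf n c U ybar q) y) (f x) := by
      rw [DxyC, hgr]
    have hgf : xOf n c U ybar (f x) = x := hinjf.leftInvOn_invFunOn hxc
    by_cases hxU : x ∈ U
    · left
      refine ⟨hxU, ?_⟩
      rw [hD]
      have h1 := (hfinv x hxc (-(A x ybar)) (hAd x hxc ybar hy).neg).2
      rw [aux_neg_inv n _ (hAinv x hxc ybar hy)] at h1
      have h2 : HasFDerivWithinAt (fun x' => gradY n c x' y) (A x y) (closure U)
          (xOf n c U ybar (f x)) := by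
        rw [hgf]; exact hAd x hxc y (subset_closure hy')
      have hm : MapsTo (xOf n c U ybar) (f '' closure U) (closure U) := by
        rintro _ ⟨z, hz, rfl⟩
        have : xOf n c U ybar (f z) = z := hinjf.leftInvOn_invFunOn hz
        rw [this]; exact hz
      have h3 := HasFDerivWithinAt.comp (f := xOf n c U ybar) (f x) h2 h1 hm
      have hnh : f '' closure U ∈ nhds (f x) :=
        Filter.mem_of_superset (hfo.mem_nhds ⟨x, hxU, rfl⟩) (image_mono subset_closure)
      exact (h3.hasFDerivAt hnh).fderiv
    · right
      have hxf : x ∈ frontier U := by rw [hUo.frontier_eq]; exact ⟨hxc, hxU⟩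
      refine ⟨?_, ?_⟩
      · rcases Nat.eq_zero_or_pos n with hn | hn
        · exfalso
          subst hn
          obtain ⟨z, hz⟩ := hUne
          exact hxU (Subsingleton.elim z x ▸ hz)
        · exact hn
      · rw [hD]
        refine aux_bdry n (f '' U) hfo (hB2.1 ybar hy) (hUne.image f) (f x) (hfrn x hxf) _
          (gradY n c (Classical.choice inferInstance) y) ?_
        intro p hp
        rw [← hfcl] at hp
        have : xOf n c U ybar p = Classical.choice inferInstance := Function.invFunOn_neg hp
        rw [this]
  have hfcont : ContinuousOn f (closure U) := (hB1.1 ybar hy).2.1.continuousOn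
  have hfdiff : DifferentiableOn ℝ f (closure U) := (hB1.1 ybar hy).2.1.differentiableOn one_ne_zero
  have key : ∀ X : Set (Euc n), X ⊆ Uyset n c U' ybar → MeasurableSet X →
      (closure U ∩ f ⁻¹' X) ⊆ U' ∧ MeasurableSet (closure U ∩ f ⁻¹' X) ∧
      volume X ≤ ENNReal.ofReal (gammaPlus n c U' V) * volume (closure U ∩ f ⁻¹' X) ∧
      volume (closure U ∩ f ⁻¹' X) ≤ ENNReal.ofReal (gammaMinus n c U' V) * volume X := by
    intro X hX hXm
    set X' := closure U ∩ f ⁻¹' X with hX'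
    have h1 : X' ⊆ U' := by
      rintro x ⟨hxc, hxX⟩
      obtain ⟨z, hz, hzx⟩ := hX hxX
      exact hinjf (hU' hz) hxc hzx ▸ hz
    have h2 : MeasurableSet X' := by
      have h3 : X' = Subtype.val '' ((closure U).domRestrict f ⁻¹' X) := by
        ext x
        constructor
        · rintro ⟨h, h'⟩; exact ⟨⟨x, h⟩, h', rfl⟩
        · rintro ⟨⟨z, h⟩, h', rfl⟩; exact ⟨h, h'⟩
      rw [h3]
      exact isClosed_closure.measurableSet.subtype_image
        (hfcont.domRestrict.measurable hXm)
    have h4 : X = f '' X' := by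
      apply Subset.antisymm
      · intro q hq
        obtain ⟨z, hz, rfl⟩ := hX hq
        exact ⟨z, ⟨hU' hz, hq⟩, rfl⟩
      · rintro _ ⟨x, hx, rfl⟩; exact hx.2
    have hnull : volume (X' \ U) = 0 := by
      refine measure_mono_null ?_ hfr0
      rw [hUo.frontier_eq]
      exact fun x hx => ⟨hx.1.1, hx.2⟩
    have hnull' : volume (f '' (X' \ U)) = 0 :=
      addHaar_image_eq_zero_of_differentiableOn_of_addHaar_eq_zero volume
        (hfdiff.mono (fun x hx => hx.1.1)) hnull
    have h5 : volume X' = volume (X' ∩ U) := by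
      refine le_antisymm ?_ (measure_mono inter_subset_left)
      calc volume X' = volume ((X' ∩ U) ∪ (X' \ U)) := by rw [inter_union_sdiff]
        _ ≤ volume (X' ∩ U) + volume (X' \ U) := measure_union_le _ _
        _ = volume (X' ∩ U) := by rw [hnull, add_zero]
    have h6 : volume X = volume (f '' (X' ∩ U)) := by
      refine le_antisymm ?_ (measure_mono (by rw [h4]; exact image_mono inter_subset_left))
      calc volume X = volume (f '' (X' ∩ U) ∪ f '' (X' \ U)) := by
            rw [← image_union, inter_union_sdiff, ← h4]
        _ ≤ volume (f '' (X' ∩ U)) + volume (f '' (X' \ U)) := measure_union_le _ _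
        _ = volume (f '' (X' ∩ U)) := by rw [hnull', add_zero]
    have hms : MeasurableSet (X' ∩ U) := h2.inter hUo.measurableSet
    have h7 := lintegral_abs_det_fderiv_eq_addHaar_image volume hms
      (f := f) (f' := fun x => -(A x ybar))
      (fun x hx => ((hAd x hx.1.1 ybar hy).neg).mono (fun z hz => hz.1.1))
      (hinjf.mono (fun z hz => hz.1.1))
    have hdd : ∀ x, |(-(A x ybar)).det| = |LinearMap.det (A x ybar : Euc n →ₗ[ℝ] Euc n)| :=
      fun x => aux_absdet_neg n (A x ybar)
    refine ⟨h1, h2, ?_, ?_⟩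
    · rw [h6, ← h7, h5, ← setLIntegral_const]
      refine setLIntegral_mono' hms ?_
      intro x hx
      rw [hdd]
      exact ENNReal.ofReal_le_ofReal (bgp x (h1 hx.1) hx.2 ybar hy)
    · rw [h6, ← h7, h5, ← lintegral_const_mul' _ _ ENNReal.ofReal_ne_top, ← setLIntegral_one]
      refine setLIntegral_mono' hms ?_
      intro x hx
      rw [hdd, ← ENNReal.ofReal_mul hgm0, ← ENNReal.ofReal_one]
      apply ENNReal.ofReal_le_ofReal
      have hpos : 0 < |LinearMap.det (A x ybar : Euc n →ₗ[ℝ] Euc n)| :=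
        abs_pos.2 (hdet0 _ (hAinv x hx.1.1 ybar hy))
      calc (1 : ℝ) = |LinearMap.det (A x ybar : Euc n →ₗ[ℝ] Euc n)|⁻¹ *
            |LinearMap.det (A x ybar : Euc n →ₗ[ℝ] Euc n)| := (inv_mul_cancel₀ hpos.ne').symm
        _ ≤ _ := mul_le_mul_of_nonneg_right (bgm x (h1 hx.1) hx.2 ybar hy) hpos.le
  refine ⟨?_, ?_, ?_, ?_, ?_, ?_⟩
  · intro X hX hXm
    obtain ⟨h1, h2, h3, -⟩ := key X hX hXm
    rw [aux_img n c U (closure V) u ybar hinjf X]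
    refine le_trans ?_ (hge _ h1 h2)
    rcases hgp0.eq_or_lt with h0 | h0
    · rw [← h0]; simp
    · calc _ ≤ ENNReal.ofReal (lam / gammaPlus n c U' V) *
            (ENNReal.ofReal (gammaPlus n c U' V) * volume (closure U ∩ f ⁻¹' X)) := by gcongr
        _ = _ := by
          rw [← mul_assoc, ← ENNReal.ofReal_mul (by positivity), div_mul_cancel₀ _ h0.ne']
  · intro X hX hXm
    obtain ⟨h1, h2, -, h3⟩ := key X hX hXm
    rw [aux_img n c U (closure V) u ybar hinjf X]
    refine (hle _ h1 h2).trans ?_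
    rw [ENNReal.ofReal_mul hLam.le, mul_assoc]
    gcongr
  · refine Real.sSup_le ?_ (mul_nonneg hgp0 hgm0)
    rintro _ ⟨⟨_, y⟩, ⟨⟨x, hx, rfl⟩, hy'⟩, rfl⟩
    have hyc := subset_closure hy'
    have hxc := hU' hx
    rcases hmod x hx y hy' with ⟨hxU, h⟩ | ⟨hn, h⟩
    · change |LinearMap.det ((DxyC n (modCost n c U ybar) (f x) y : Euc n →L[ℝ] Euc n) :
        Euc n →ₗ[ℝ] Euc n)| ≤ _
      rw [h, ContinuousLinearMap.toLinearMap_comp, LinearMap.det_comp, abs_mul, aux_absdet_neg]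
      have h1 := aux_det_inv n _ (hAinv x hxc ybar hy)
      rw [eq_inv_of_mul_eq_one_left h1, abs_inv]
      exact mul_le_mul (bgp x hx hxU y hyc) (bgm x hx hxU ybar hy) (by positivity) hgp0
    · change |LinearMap.det ((DxyC n (modCost n c U ybar) (f x) y : Euc n →L[ℝ] Euc n) :
        Euc n →ₗ[ℝ] Euc n)| ≤ _
      rw [h]
      simp [hn.ne', mul_nonneg hgp0 hgm0]
  · refine Real.sSup_le ?_ (mul_nonneg hgp0 hgm0)
    rintro _ ⟨⟨_, y⟩, ⟨⟨x, hx, rfl⟩, hy'⟩, rfl⟩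
    have hyc := subset_closure hy'
    have hxc := hU' hx
    rcases hmod x hx y hy' with ⟨hxU, h⟩ | ⟨hn, h⟩
    · change |LinearMap.det ((DxyC n (modCost n c U ybar) (f x) y : Euc n →L[ℝ] Euc n) :
        Euc n →ₗ[ℝ] Euc n)|⁻¹ ≤ _
      rw [h, ContinuousLinearMap.toLinearMap_comp, LinearMap.det_comp, abs_mul, aux_absdet_neg]
      have h1 := aux_det_inv n _ (hAinv x hxc ybar hy)
      rw [eq_inv_of_mul_eq_one_left h1, abs_inv, mul_inv, inv_inv, mul_comm]
      exact mul_le_mul (bgp x hx hxU ybar hy) (bgm x hx hxU y hyc) (by positivity) hgp0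
    · change |LinearMap.det ((DxyC n (modCost n c U ybar) (f x) y : Euc n →L[ℝ] Euc n) :
        Euc n →ₗ[ℝ] Euc n)|⁻¹ ≤ _
      rw [h]
      simp [hn.ne', mul_nonneg hgp0 hgm0]
  · refine Real.sSup_le ?_ (mul_nonneg hbp0 hbm0)
    rintro _ ⟨⟨_, y⟩, ⟨⟨x, hx, rfl⟩, hy'⟩, rfl⟩
    have hyc := subset_closure hy'
    change ‖DxyC n (modCost n c U ybar) (f x) y‖ ≤ _
    rcases hmod x hx y hy' with ⟨hxU, h⟩ | ⟨hn, h⟩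
    · rw [h]
      refine (ContinuousLinearMap.opNorm_comp_le _ _).trans ?_
      rw [norm_neg]
      exact mul_le_mul (bbp x hx hxU y hyc) (bbm x hx hxU ybar hy) (norm_nonneg _) hbp0
    · rw [h, norm_zero]; exact mul_nonneg hbp0 hbm0
  · refine Real.sSup_le ?_ (mul_nonneg hbp0 hbm0)
    rintro _ ⟨⟨_, y⟩, ⟨⟨x, hx, rfl⟩, hy'⟩, rfl⟩
    have hyc := subset_closure hy'
    have hxc := hU' hx
    change ‖(DxyC n (modCost n c U ybar) (f x) y).inverse‖ ≤ _
    rcases hmod x hx y hy' with ⟨hxU, h⟩ | ⟨hn, h⟩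
    · have h1 : ((A x y).comp (-(A x ybar).inverse)).inverse =
          -((A x ybar).comp (A x y).inverse) := by
        obtain ⟨e, he⟩ := hAinv x hxc ybar hy
        obtain ⟨e', he'⟩ := hAinv x hxc y hyc
        rw [← he, ← he']
        apply ContinuousLinearMap.inverse_eq
        · ext1 v; simp
        · ext1 v; simp
      rw [h, h1, norm_neg]
      refine (ContinuousLinearMap.opNorm_comp_le _ _).trans ?_
      exact mul_le_mul (bbp x hx hxU ybar hy) (bbm x hx hxU y hyc) (norm_nonneg _) hbp0
    · rw [h, ContinuousLinearMap.inverse_zero, norm_zero]; exact mul_nonneg hbp0 hbm0
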